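/- Let μ be a probability measure on ℝ with support contained in [−R, R] (R > 0). Let F and G be the cumulative distribution functions of the standard Gaussian γ_1 and of μ*γ_1 respectively. Then for all x with |x| ≥ 2R, the derivative of G⁻¹∘F satisfies (G⁻¹∘F)'(x) ≤ exp(2R² + 2R + 1/8). -/

import Mathlib

open MeasureTheory Real Filter

/-- The standard Gaussian density `p(t) = (2π)^{-1/2} exp(−t²/2)`. -/
noncomputable def stdp (t : ℝ) : ℝ := (2 * π) ^ (-(1 : ℝ) / 2) * Real.exp (-t ^ 2 / 2)

/-- `q(t) = ∫_{[−R,R]} p(t−s) dμ(s)`, the density of `μ ∗ γ₁`. -/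
noncomputable def qdens (μ : Measure ℝ) (R : ℝ) (t : ℝ) : ℝ :=
  ∫ s in Set.Icc (-R) R, stdp (t - s) ∂μ

/-- `Λ(x) = ∫_{[−R,R]} e^{xs} dμ(s)`. -/
noncomputable def Lam (μ : Measure ℝ) (R : ℝ) (x : ℝ) : ℝ :=
  ∫ s in Set.Icc (-R) R, Real.exp (x * s) ∂μ

/-- `K(x) = (log Λ(x) + R) / x`. -/
noncomputable def Kfun (μ : Measure ℝ) (R : ℝ) (x : ℝ) : ℝ :=
  (Real.log (Lam μ R x) + R) / x

/-- `F`, the cumulative distribution function of the standard Gaussian `γ₁`. -/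
noncomputable def Fcdf (x : ℝ) : ℝ := ∫ t in Set.Iic x, stdp t

/-- `G`, the cumulative distribution function of `μ ∗ γ₁`. -/
noncomputable def Gcdf (μ : Measure ℝ) (R : ℝ) (x : ℝ) : ℝ :=
  ∫ t in Set.Iic x, qdens μ R t

/-- Unnormalised Mills ratio. -/
noncomputable def millsM (y : ℝ) : ℝ := ∫ u in Set.Ioi (0:ℝ), Real.exp (-(u * y) - u ^ 2 / 2)

theorem gauss_shift_integrable (y : ℝ) :
    Integrable (fun u : ℝ => Real.exp (-(u * y) - u ^ 2 / 2)) := by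
  have h := (integrable_exp_neg_mul_sq (b := 1/2) (by norm_num)).comp_add_right y
  have h2 := h.const_mul (Real.exp (y ^ 2 / 2))
  refine h2.congr (Eventually.of_forall fun u => ?_)
  simp only
  rw [← Real.exp_add]
  congr 1
  ring

theorem millsM_pos (y : ℝ) : 0 < millsM y := by
  unfold millsM
  rw [setIntegral_pos_iff_support_of_nonneg_ae]
  · have : Function.support (fun u : ℝ => Real.exp (-(u * y) - u ^ 2 / 2)) = Set.univ := by
      ext u; simp [Real.exp_ne_zero]
    rw [this]; simp
  · exact Eventually.of_forall fun u => (Real.exp_pos _).le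
  · exact (gauss_shift_integrable y).integrableOn

theorem millsM_anti {a b : ℝ} (h : a ≤ b) : millsM b ≤ millsM a := by
  unfold millsM
  refine setIntegral_mono_on (gauss_shift_integrable b).integrableOn
    (gauss_shift_integrable a).integrableOn measurableSet_Ioi fun u hu => ?_
  have hu : (0:ℝ) < u := hu
  apply Real.exp_le_exp.2
  nlinarith

theorem millsM_ratio (y d : ℝ) (hy : 0 ≤ y) (hd : 0 ≤ d) :
    millsM y ≤ Real.exp d * millsM (y + d) := by
  set k := Real.sqrt (1 + d) with hk
  have hk2 : k ^ 2 = 1 + d := Real.sq_sqrt (by linarith)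
  have hk1 : 1 ≤ k := by rw [hk]; exact Real.one_le_sqrt.2 (by linarith)
  have hk0 : 0 < k := by linarith
  have hke : k ≤ Real.exp (d / 2) := by
    rw [hk]
    apply Real.sqrt_le_iff.2
    refine ⟨(Real.exp_pos _).le, ?_⟩
    rw [← Real.exp_nat_mul]
    have := Real.add_one_le_exp d
    have e : ((2:ℕ):ℝ) * (d / 2) = d := by push_cast; ring
    rw [e]; linarith
  have h1 : k * ∫ u in Set.Ioi (0:ℝ), Real.exp (-((k * u) * (y / k)) - (k * u) ^ 2 / 2)
      = millsM (y / k) := by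
    have := integral_comp_mul_left_Ioi'
      (fun u : ℝ => Real.exp (-(u * (y / k)) - u ^ 2 / 2)) 0 hk0
    simpa [millsM] using this
  have h2 : millsM y ≤ millsM (y / k) :=
    millsM_anti (div_le_self hy hk1)
  have h3 : (∫ u in Set.Ioi (0:ℝ), Real.exp (-((k * u) * (y / k)) - (k * u) ^ 2 / 2))
      ≤ Real.exp (d / 2) * millsM (y + d) := by
    unfold millsM
    rw [← integral_const_mul]
    refine setIntegral_mono_on ?_ ((gauss_shift_integrable _).integrableOn.const_mul _)
      measurableSet_Ioi fun u hu => ?_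
    · exact ((gauss_shift_integrable (y / k)).comp_mul_left' hk0.ne').integrableOn
    · rw [← Real.exp_add]
      apply Real.exp_le_exp.2
      have e : (k * u) * (y / k) = u * y := by field_simp
      rw [e, mul_pow, hk2]
      nlinarith [mul_nonneg hd (sq_nonneg (u - 1))]
  have hM := millsM_pos (y + d)
  calc millsM y ≤ millsM (y / k) := h2
    _ = k * _ := h1.symm
    _ ≤ k * (Real.exp (d / 2) * millsM (y + d)) := by gcongr
    _ ≤ Real.exp (d / 2) * (Real.exp (d / 2) * millsM (y + d)) := by gcongr
    _ = Real.exp d * millsM (y + d) := by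
      rw [← mul_assoc, ← Real.exp_add]; congr 2; ring

theorem stdp_pos (t : ℝ) : 0 < stdp t := by
  unfold stdp
  have := Real.pi_pos
  positivity

theorem stdp_cont : Continuous stdp := by
  unfold stdp; fun_prop

theorem stdp_integrable : Integrable stdp := by
  refine ((gauss_shift_integrable 0).const_mul ((2 * π) ^ (-(1 : ℝ) / 2))).congr
    (Eventually.of_forall fun u => ?_)
  simp only [stdp]
  congr 2
  ring

theorem stdp_le (t : ℝ) : stdp t ≤ stdp 0 := by
  unfold stdp
  have := Real.pi_pos
  refine mul_le_mul_of_nonneg_left (Real.exp_le_exp.2 ?_) (by positivity)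
  nlinarith [sq_nonneg t]

theorem stdp_add (x u : ℝ) : stdp (x + u) = stdp x * Real.exp (-(u * x) - u ^ 2 / 2) := by
  unfold stdp
  rw [mul_assoc, ← Real.exp_add]
  congr 2; ring

theorem stdp_sub (x u : ℝ) : stdp (x - u) = stdp x * Real.exp (-(u * (-x)) - u ^ 2 / 2) := by
  unfold stdp
  rw [mul_assoc, ← Real.exp_add]
  congr 2; ring

theorem hasDerivAt_cdf (f : ℝ → ℝ) (hf : Continuous f) (hi : Integrable f) (x : ℝ) :
    HasDerivAt (fun x => ∫ t in Set.Iic x, f t) (f x) x := by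
  have h : (fun x => ∫ t in Set.Iic x, f t)
      = fun x => (∫ t in Set.Iic (0:ℝ), f t) + ∫ t in (0:ℝ)..x, f t := by
    funext x
    have := intervalIntegral.integral_Iic_sub_Iic (f := f) (μ := volume) (a := 0) (b := x)
      hi.integrableOn hi.integrableOn
    linarith
  rw [h]
  exact (intervalIntegral.integral_hasDerivAt_right (hf.intervalIntegrable _ _)
    hf.stronglyMeasurable.stronglyMeasurableAtFilter hf.continuousAt).const_add _

theorem tail_right (f : ℝ → ℝ) (x : ℝ) :
    ∫ t in Set.Ioi x, f t = ∫ u in Set.Ioi (0:ℝ), f (x + u) := by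
  rw [← integral_indicator measurableSet_Ioi, ← integral_indicator measurableSet_Ioi,
    ← integral_add_left_eq_self _ x]
  congr 1; funext u
  by_cases h : 0 < u <;> simp [Set.indicator, h]

theorem tail_left (f : ℝ → ℝ) (x : ℝ) :
    ∫ t in Set.Iic x, f t = ∫ u in Set.Ioi (0:ℝ), f (x - u) := by
  rw [integral_Iic_eq_integral_Iio,
    ← integral_indicator measurableSet_Iio, ← integral_indicator measurableSet_Ioi,
    ← integral_sub_left_eq_self _ volume x]
  congr 1; funext u
  by_cases h : 0 < u <;> simp [Set.indicator, h]

theorem cdf_shift (f : ℝ → ℝ) (x s : ℝ) :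
    ∫ t in Set.Iic x, f (t - s) = ∫ t in Set.Iic (x - s), f t := by
  rw [← integral_indicator measurableSet_Iic, ← integral_indicator measurableSet_Iic,
    ← integral_sub_right_eq_self ((Set.Iic (x - s)).indicator fun t => f t) s]
  congr 1; funext u
  by_cases h : u ≤ x <;> simp [Set.indicator, h]

theorem Fcdf_strictMono : StrictMono Fcdf := by
  intro a b hab
  have := intervalIntegral.integral_Iic_sub_Iic (f := stdp) (μ := volume) (a := a) (b := b)
      stdp_integrable.integrableOn stdp_integrable.integrableOn
  have h2 := intervalIntegral.intervalIntegral_pos_of_pos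
    (stdp_cont.intervalIntegrable a b) stdp_pos hab
  unfold Fcdf
  linarith

section meas

variable (μ : Measure ℝ) [IsProbabilityMeasure μ] (R : ℝ)

theorem ae_Icc (hsupp : μ (Set.Icc (-R) R)ᶜ = 0) : ∀ᵐ s ∂μ, s ∈ Set.Icc (-R) R := by
  rw [ae_iff]; exact hsupp

theorem qdens_eq (hsupp : μ (Set.Icc (-R) R)ᶜ = 0) (t : ℝ) :
    qdens μ R t = ∫ s, stdp (t - s) ∂μ := by
  unfold qdens
  rw [Measure.restrict_eq_self_of_ae_mem (ae_Icc μ R hsupp)]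

theorem stdp_mu_int (t : ℝ) : Integrable (fun s => stdp (t - s)) μ := by
  refine Integrable.of_bound (C := stdp 0) ?_ (Eventually.of_forall fun s => ?_)
  · exact (stdp_cont.comp (by fun_prop : Continuous fun s : ℝ => t - s)).aestronglyMeasurable
  · rw [Real.norm_of_nonneg (stdp_pos _).le]; exact stdp_le _

theorem qdens_pos (hsupp : μ (Set.Icc (-R) R)ᶜ = 0) (t : ℝ) : 0 < qdens μ R t := by
  rw [qdens_eq μ R hsupp, integral_pos_iff_support_of_nonneg
    (fun s => (stdp_pos _).le) (stdp_mu_int μ t)]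
  have : Function.support (fun s : ℝ => stdp (t - s)) = Set.univ := by
    ext u; simp [(stdp_pos _).ne']
  rw [this]; simp

theorem qdens_cont (hsupp : μ (Set.Icc (-R) R)ᶜ = 0) : Continuous (qdens μ R) := by
  have : qdens μ R = fun t => ∫ s, stdp (t - s) ∂μ := funext (qdens_eq μ R hsupp)
  rw [this]
  refine continuous_of_dominated (bound := fun _ => stdp 0) ?_ ?_ (integrable_const _) ?_
  · exact fun t => (stdp_mu_int μ t).aestronglyMeasurable
  · intro t
    refine Eventually.of_forall fun s => ?_
    rw [Real.norm_of_nonneg (stdp_pos _).le]; exact stdp_le _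
  · exact Eventually.of_forall fun s => stdp_cont.comp (by fun_prop)

theorem prod_int : Integrable (Function.uncurry fun t s : ℝ => stdp (t - s))
    ((volume : Measure ℝ).prod μ) := by
  rw [integrable_prod_iff']
  · refine ⟨Eventually.of_forall fun s => stdp_integrable.comp_sub_right s, ?_⟩
    have : (fun s : ℝ => ∫ t : ℝ, ‖Function.uncurry (fun t s : ℝ => stdp (t - s)) (t, s)‖)
        = fun s : ℝ => ∫ t : ℝ, ‖stdp t‖ := by
      funext s
      exact integral_sub_right_eq_self (fun t => ‖stdp t‖) s
    rw [this]
    exact integrable_const _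
  · exact (stdp_cont.comp (by fun_prop : Continuous fun z : ℝ × ℝ => z.1 - z.2)).aestronglyMeasurable

theorem prod_int_restrict (S : Set ℝ) : Integrable (Function.uncurry fun t s : ℝ => stdp (t - s))
    (((volume : Measure ℝ).restrict S).prod μ) := by
  have h := (prod_int μ).restrict (s := S ×ˢ Set.univ)
  rwa [← Measure.prod_restrict, Measure.restrict_univ] at h

theorem qdens_integrable (hsupp : μ (Set.Icc (-R) R)ᶜ = 0) : Integrable (qdens μ R) := by
  have : qdens μ R = fun t => ∫ s, stdp (t - s) ∂μ := funext (qdens_eq μ R hsupp)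
  rw [this]
  exact (prod_int μ).integral_prod_left

theorem qdens_total (hsupp : μ (Set.Icc (-R) R)ᶜ = 0) : ∫ t, qdens μ R t = ∫ t, stdp t := by
  have : qdens μ R = fun t => ∫ s, stdp (t - s) ∂μ := funext (qdens_eq μ R hsupp)
  rw [this, integral_integral_swap (prod_int μ)]
  simp [integral_sub_right_eq_self stdp]

theorem Gcdf_eq (hsupp : μ (Set.Icc (-R) R)ᶜ = 0) (T : ℝ) :
    Gcdf μ R T = ∫ s, Fcdf (T - s) ∂μ := by
  unfold Gcdf Fcdf
  have : qdens μ R = fun t => ∫ s, stdp (t - s) ∂μ := funext (qdens_eq μ R hsupp)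
  rw [this, integral_integral_swap (prod_int_restrict μ _)]
  simp_rw [cdf_shift stdp]

theorem Fcdf_int (T : ℝ) : Integrable (fun s => Fcdf (T - s)) μ := by
  have := (prod_int_restrict μ (Set.Iic T)).integral_prod_right
  refine this.congr (Eventually.of_forall fun s => ?_)
  exact cdf_shift stdp T s

theorem Gcdf_le (hsupp : μ (Set.Icc (-R) R)ᶜ = 0) (T : ℝ) : Gcdf μ R T ≤ Fcdf (T + R) := by
  rw [Gcdf_eq μ R hsupp]
  calc ∫ s, Fcdf (T - s) ∂μ ≤ ∫ s, Fcdf (T + R) ∂μ := by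
        refine integral_mono_ae (Fcdf_int μ T) (integrable_const _) ?_
        filter_upwards [ae_Icc μ R hsupp] with s hs
        exact Fcdf_strictMono.monotone (by linarith [hs.1])
    _ = _ := by simp

theorem le_Gcdf (hsupp : μ (Set.Icc (-R) R)ᶜ = 0) (T : ℝ) : Fcdf (T - R) ≤ Gcdf μ R T := by
  rw [Gcdf_eq μ R hsupp]
  calc Fcdf (T - R) = ∫ s, Fcdf (T - R) ∂μ := by simp
    _ ≤ ∫ s, Fcdf (T - s) ∂μ := by
        refine integral_mono_ae (integrable_const _) (Fcdf_int μ T) ?_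
        filter_upwards [ae_Icc μ R hsupp] with s hs
        exact Fcdf_strictMono.monotone (by linarith [hs.2])

theorem qdens_add_le (hsupp : μ (Set.Icc (-R) R)ᶜ = 0) (T u : ℝ) (hu : 0 < u) :
    qdens μ R (T + u) ≤ qdens μ R T * Real.exp (-(u * (T - R)) - u ^ 2 / 2) := by
  rw [qdens_eq μ R hsupp, qdens_eq μ R hsupp, ← integral_mul_const]
  refine integral_mono_ae (stdp_mu_int μ _) ((stdp_mu_int μ _).mul_const _) ?_
  filter_upwards [ae_Icc μ R hsupp] with s hs
  have e : T + u - s = (T - s) + u := by ring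
  rw [e, stdp_add]
  refine mul_le_mul_of_nonneg_left (Real.exp_le_exp.2 ?_) (stdp_pos _).le
  nlinarith [hs.2]

theorem qdens_sub_le (hsupp : μ (Set.Icc (-R) R)ᶜ = 0) (T u : ℝ) (hu : 0 < u) :
    qdens μ R (T - u) ≤ qdens μ R T * Real.exp (-(u * (-T - R)) - u ^ 2 / 2) := by
  rw [qdens_eq μ R hsupp, qdens_eq μ R hsupp, ← integral_mul_const]
  refine integral_mono_ae (stdp_mu_int μ _) ((stdp_mu_int μ _).mul_const _) ?_
  filter_upwards [ae_Icc μ R hsupp] with s hs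
  have e : T - u - s = (T - s) - u := by ring
  rw [e, stdp_sub]
  refine mul_le_mul_of_nonneg_left (Real.exp_le_exp.2 ?_) (stdp_pos _).le
  nlinarith [hs.1]

theorem qtail_right (hsupp : μ (Set.Icc (-R) R)ᶜ = 0) (T : ℝ) :
    ∫ t in Set.Ioi T, qdens μ R t ≤ qdens μ R T * millsM (T - R) := by
  rw [tail_right, millsM, ← integral_const_mul]
  exact setIntegral_mono_on ((qdens_integrable μ R hsupp).comp_add_left T).integrableOn
    ((gauss_shift_integrable _).const_mul _).integrableOn measurableSet_Ioi
    fun u hu => qdens_add_le μ R hsupp T u hu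

theorem qtail_left (hsupp : μ (Set.Icc (-R) R)ᶜ = 0) (T : ℝ) :
    Gcdf μ R T ≤ qdens μ R T * millsM (-T - R) := by
  rw [Gcdf, tail_left, millsM, ← integral_const_mul]
  exact setIntegral_mono_on ((qdens_integrable μ R hsupp).comp_sub_left T).integrableOn
    ((gauss_shift_integrable _).const_mul _).integrableOn measurableSet_Ioi
    fun u hu => qdens_sub_le μ R hsupp T u hu

theorem ptail_right (x : ℝ) : ∫ t in Set.Ioi x, stdp t = stdp x * millsM x := by
  rw [tail_right, millsM, ← integral_const_mul]
  simp_rw [stdp_add]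

theorem ptail_left (x : ℝ) : Fcdf x = stdp x * millsM (-x) := by
  rw [Fcdf, tail_left, millsM, ← integral_const_mul]
  simp_rw [stdp_sub]

theorem key_ineq (hR : 0 < R) (hsupp : μ (Set.Icc (-R) R)ᶜ = 0) (x T : ℝ)
    (hT : Gcdf μ R T = Fcdf x) (hx : 2 * R ≤ |x|) :
    stdp x ≤ Real.exp (2 * R) * qdens μ R T := by
  have b1 : x ≤ T + R := Fcdf_strictMono.le_iff_le.1 (hT ▸ Gcdf_le μ R hsupp T)
  have b2 : T - R ≤ x := Fcdf_strictMono.le_iff_le.1 (hT ▸ le_Gcdf μ R hsupp T)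
  have hq := (qdens_pos μ R hsupp T).le
  have main : stdp x * millsM |x| ≤ qdens μ R T * millsM (|x| - 2 * R) := by
    rcases le_total 0 x with h | h
    · rw [abs_of_nonneg h]
      have e1 := intervalIntegral.integral_Iic_add_Ioi (b := x)
        stdp_integrable.integrableOn stdp_integrable.integrableOn
      have e2 := intervalIntegral.integral_Iic_add_Ioi (b := T)
        (qdens_integrable μ R hsupp).integrableOn (qdens_integrable μ R hsupp).integrableOn
      rw [qdens_total μ R hsupp] at e2
      have hT' : ∫ t in Set.Iic T, qdens μ R t = ∫ t in Set.Iic x, stdp t := hT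
      have e3 := qtail_right μ R hsupp T
      have e4 := ptail_right x
      have e5 : qdens μ R T * millsM (T - R) ≤ qdens μ R T * millsM (x - 2 * R) :=
        mul_le_mul_of_nonneg_left (millsM_anti (by linarith)) hq
      linarith
    · rw [abs_of_nonpos h]
      have e3 := qtail_left μ R hsupp T
      have e4 := ptail_left x
      have e5 : qdens μ R T * millsM (-T - R) ≤ qdens μ R T * millsM (-x - 2 * R) :=
        mul_le_mul_of_nonneg_left (millsM_anti (by linarith)) hq
      linarith
  have hr := millsM_ratio (|x| - 2 * R) (2 * R) (by linarith) (by linarith)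
  rw [sub_add_cancel] at hr
  have hm := millsM_pos |x|
  have h5 := mul_le_mul_of_nonneg_left hr hq
  refine le_of_mul_le_mul_right ?_ hm
  linarith

end meas

theorem stmt13 (μ : Measure ℝ) [IsProbabilityMeasure μ] (R : ℝ) (hR : 0 < R)
    (hsupp : μ (Set.Icc (-R) R)ᶜ = 0)
    (H : ℝ → ℝ) (hH : ∀ x, Gcdf μ R (H x) = Fcdf x) :
    ∀ x : ℝ, 2 * R ≤ |x| → deriv H x ≤ Real.exp (2 * R ^ 2 + 2 * R + 1 / 8) := by
  intro x hx
  by_cases hd : DifferentiableAt ℝ H x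
  · have h1 : HasDerivAt (Gcdf μ R) (qdens μ R (H x)) (H x) :=
      hasDerivAt_cdf _ (qdens_cont μ R hsupp) (qdens_integrable μ R hsupp) _
    have h2 : HasDerivAt Fcdf (stdp x) x := hasDerivAt_cdf _ stdp_cont stdp_integrable _
    have h3 := h1.comp x hd.hasDerivAt
    have h4 : Gcdf μ R ∘ H = Fcdf := funext hH
    rw [h4] at h3
    have h5 := h3.unique h2
    have h6 := key_ineq μ R hR hsupp x (H x) (hH x) hx
    have hq := qdens_pos μ R hsupp (H x)
    have h7 : deriv H x ≤ Real.exp (2 * R) := by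
      refine le_of_mul_le_mul_left ?_ hq
      linarith
    refine h7.trans (Real.exp_le_exp.2 ?_)
    nlinarith [sq_nonneg R]
  · rw [deriv_zero_of_not_differentiableAt hd]
    exact (Real.exp_pos _).le
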